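/- Let f : A → B be a homotopy equivalence of C*-algebras and let D be any C*-algebra. Then post-composition with f induces a continuous map Hom⋆(D,A) → Hom⋆(D,B) (hom-sets carrying the topology of pointwise norm convergence), and this map is a homotopy equivalence of topological spaces: there is a continuous map Hom⋆(D,B) → Hom⋆(D,A) such that both composites are homotopic to the respective identity maps through continuous homotopies. -/

import Mathlib

/-- The topology of pointwise norm convergence on the set of ⋆-homomorphisms between
C⋆-algebras: the topology induced by the inclusion into the space of all functions `A → B`
with the product topology, where `B` carries its norm topology. -/
noncomputable instance starAlgHomPointwiseTopology (A B : Type*) [NonUnitalCStarAlgebra A]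
    [NonUnitalCStarAlgebra B] : TopologicalSpace (A →⋆ₙₐ[ℂ] B) :=
  TopologicalSpace.induced (fun φ => (φ : A → B)) Pi.topologicalSpace

/-- Two ⋆-homomorphisms `f₀ f₁ : A → B` between C⋆-algebras are homotopic if there is a
⋆-homomorphism `H : A → C([0,1], B)` with `(H a) 0 = f₀ a` and `(H a) 1 = f₁ a` for all `a`. -/
def StarAlgHomHomotopic {A B : Type*} [NonUnitalCStarAlgebra A] [NonUnitalCStarAlgebra B]
    (f₀ f₁ : A →⋆ₙₐ[ℂ] B) : Prop :=
  ∃ H : A →⋆ₙₐ[ℂ] C(unitInterval, B), ∀ a, H a 0 = f₀ a ∧ H a 1 = f₁ a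

/-- A ⋆-homomorphism `f : A → B` between C⋆-algebras is a homotopy equivalence if there is a
⋆-homomorphism `g : B → A` with `g ∘ f` homotopic to `id_A` and `f ∘ g` homotopic to `id_B`. -/
def IsStarAlgHomotopyEquiv {A B : Type*} [NonUnitalCStarAlgebra A] [NonUnitalCStarAlgebra B]
    (f : A →⋆ₙₐ[ℂ] B) : Prop :=
  ∃ g : B →⋆ₙₐ[ℂ] A,
    StarAlgHomHomotopic (g.comp f) (NonUnitalStarAlgHom.id ℂ A) ∧
    StarAlgHomHomotopic (f.comp g) (NonUnitalStarAlgHom.id ℂ B)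

/-- A map into `Hom⋆(A, B)` is continuous iff all of its evaluations are continuous. -/
theorem continuous_starAlgHom_iff {X A B : Type*} [TopologicalSpace X] [NonUnitalCStarAlgebra A]
    [NonUnitalCStarAlgebra B] {F : X → (A →⋆ₙₐ[ℂ] B)} :
    Continuous F ↔ ∀ a, Continuous fun x => F x a := by
  rw [continuous_induced_rng, continuous_pi_iff]
  rfl

/-- Evaluation `Hom⋆(A, B) → B` at an element of `A` is continuous. -/
theorem continuous_starAlgHom_apply {A B : Type*} [NonUnitalCStarAlgebra A]
    [NonUnitalCStarAlgebra B] (a : A) : Continuous fun φ : A →⋆ₙₐ[ℂ] B => φ a :=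
  continuous_starAlgHom_iff.1 continuous_id a

/-- A ⋆-homomorphism between C⋆-algebras is continuous. -/
theorem continuous_of_starAlgHom {A B : Type*} [NonUnitalCStarAlgebra A]
    [NonUnitalCStarAlgebra B] (f : A →⋆ₙₐ[ℂ] B) : Continuous f :=
  AddMonoidHomClass.continuous_of_bound f 1 fun a => by
    simpa only [one_mul] using NonUnitalStarAlgHom.norm_apply_le f a

/-- Evaluation at a point `t` as a ⋆-homomorphism `C([0,1], B) → B`. -/
def unitIntervalEvalStarAlgHom (B : Type*) [NonUnitalCStarAlgebra B] (t : unitInterval) :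
    C(unitInterval, B) →⋆ₙₐ[ℂ] B where
  toFun u := u t
  map_smul' _ _ := rfl
  map_zero' := rfl
  map_add' _ _ := rfl
  map_mul' _ _ := rfl
  map_star' _ := rfl

/-- Post-composition with a ⋆-homomorphism, as a continuous map of hom-spaces. -/
def starAlgHomPostcomp {A B : Type*} (D : Type*) [NonUnitalCStarAlgebra A]
    [NonUnitalCStarAlgebra B] [NonUnitalCStarAlgebra D] (f : A →⋆ₙₐ[ℂ] B) :
    C(D →⋆ₙₐ[ℂ] A, D →⋆ₙₐ[ℂ] B) where
  toFun φ := f.comp φ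
  continuous_toFun := continuous_starAlgHom_iff.2 fun d =>
    (continuous_of_starAlgHom f).comp (continuous_starAlgHom_apply d)

/-- Homotopic ⋆-homomorphisms induce homotopic maps of hom-spaces by post-composition. -/
theorem StarAlgHomHomotopic.postcomp {A B : Type*} (D : Type*) [NonUnitalCStarAlgebra A]
    [NonUnitalCStarAlgebra B] [NonUnitalCStarAlgebra D] {f₀ f₁ : A →⋆ₙₐ[ℂ] B}
    (h : StarAlgHomHomotopic f₀ f₁) :
    (starAlgHomPostcomp D f₀).Homotopic (starAlgHomPostcomp D f₁) := by
  obtain ⟨H, hH⟩ := h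
  refine ⟨⟨⟨fun p => ((unitIntervalEvalStarAlgHom B p.1).comp H).comp p.2, ?_⟩, ?_, ?_⟩⟩
  · refine continuous_starAlgHom_iff.2 fun d => ?_
    have hc : Continuous fun p : unitInterval × (D →⋆ₙₐ[ℂ] A) => H (p.2 d) :=
      (continuous_of_starAlgHom H).comp ((continuous_starAlgHom_apply d).comp continuous_snd)
    exact hc.eval continuous_fst
  · exact fun φ => NonUnitalStarAlgHom.ext fun d => (hH (φ d)).1
  · exact fun φ => NonUnitalStarAlgHom.ext fun d => (hH (φ d)).2

/-- If `f : A → B` is a homotopy equivalence of C⋆-algebras and `D` is any C⋆-algebra, then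
post-composition with `f` is a continuous map `Hom⋆(D,A) → Hom⋆(D,B)` (hom-sets carrying the
topology of pointwise norm convergence), and it is a homotopy equivalence of topological
spaces: there is a continuous map `Hom⋆(D,B) → Hom⋆(D,A)` such that both composites are
homotopic to the identity through continuous homotopies. -/
theorem starAlgHom_postcomp_homotopyEquiv {A B : Type*} [NonUnitalCStarAlgebra A]
    [NonUnitalCStarAlgebra B] (D : Type*) [NonUnitalCStarAlgebra D]
    (f : A →⋆ₙₐ[ℂ] B) (hf : IsStarAlgHomotopyEquiv f) :
    ∃ F : C(D →⋆ₙₐ[ℂ] A, D →⋆ₙₐ[ℂ] B),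
      (∀ φ : D →⋆ₙₐ[ℂ] A, F φ = f.comp φ) ∧
      ∃ G : C(D →⋆ₙₐ[ℂ] B, D →⋆ₙₐ[ℂ] A),
        (F.comp G).Homotopic (ContinuousMap.id (D →⋆ₙₐ[ℂ] B)) ∧
        (G.comp F).Homotopic (ContinuousMap.id (D →⋆ₙₐ[ℂ] A)) := by
  obtain ⟨g, hgf, hfg⟩ := hf
  exact ⟨starAlgHomPostcomp D f, fun _ => rfl, starAlgHomPostcomp D g,
    hfg.postcomp D, hgf.postcomp D⟩
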